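/- Let 0 < ε < ε₀. There exists C = C(ε₀, ε) > 0 with the following property. Let P(x) be a 2×2 matrix whose entries a, b, c, d lie in C^ω_{ε₀}(ℝ/ℤ, ℂ), suppose det P(z) vanishes identically, and suppose δ ≤ ‖P(z)‖ ≤ 1 for all z with |Im z| < ε₀. Then there exists u ∈ C^ω_ε(ℝ/ℤ, ℂ²) such that P(z) u(z) = 0 and C^{−1} δ^C ≤ ‖u(z)‖ ≤ 1 for all z with |Im z| < ε. -/

import Mathlib

open Complex Real Filter

noncomputable section

attribute [local instance] Matrix.normedAddCommGroup Matrix.normedSpace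

/-- 2×2 complex matrices (holomorphic extensions of real matrix maps). -/
abbrev M2 : Type := Matrix (Fin 2) (Fin 2) ℂ

/-- The horizontal strip of half-width `ε` around the real axis. -/
def Strip (ε : ℝ) : Set ℂ := {z : ℂ | |z.im| < ε}

/-- Iterates of the cocycle: `cocycleIter α A k z = A(z+(k-1)α) ⋯ A(z)`, with value `1` for `k=0`. -/
def cocycleIter (α : ℝ) (A : ℂ → M2) : ℕ → ℂ → M2
  | 0 => fun _ => 1
  | k + 1 => fun z => A (z + (k : ℂ) * (α : ℂ)) * cocycleIter α A k z

/-- `A ∈ C^ω_ε(ℝ/ℤ, SL(2,ℝ))`: a 1-periodic holomorphic map on the strip of half-width `ε`,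
real-valued on `ℝ`, with determinant 1. -/
def IsSL2Strip (ε : ℝ) (A : ℂ → M2) : Prop :=
  DifferentiableOn ℂ A (Strip ε) ∧ (∀ z : ℂ, A (z + 1) = A z) ∧
  (∀ x : ℝ, ∀ i j, (A (x : ℝ) i j).im = 0) ∧ (∀ z ∈ Strip ε, (A z).det = 1)

/-- `B ∈ C^ω_ε(ℝ/ℤ, PSL(2,ℝ))`: a holomorphic map on the strip of half-width `ε`,
real-valued on `ℝ`, with determinant 1, which is 1-periodic up to sign. -/
def IsPSL2Strip (ε : ℝ) (B : ℂ → M2) : Prop :=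
  DifferentiableOn ℂ B (Strip ε) ∧
  (∃ s : ℂ, (s = 1 ∨ s = -1) ∧ ∀ z : ℂ, B (z + 1) = s • B z) ∧
  (∀ x : ℝ, ∀ i j, (B (x : ℝ) i j).im = 0) ∧ (∀ z ∈ Strip ε, (B z).det = 1)

/-- The rotation matrix `R_θ` (with holomorphic dependence on `θ`). -/
def Rot (θ : ℂ) : M2 :=
  !![Complex.cos (2 * π * θ), -Complex.sin (2 * π * θ);
     Complex.sin (2 * π * θ), Complex.cos (2 * π * θ)]

theorem exists_holomorphic_quotient {U : Set ℂ} (hU : IsOpen U) {f s : ℂ → ℂ}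
    (hf : DifferentiableOn ℂ f U) (hs : DifferentiableOn ℂ s U)
    (h : ∀ z ∈ U, s z = 0 → deriv s z ≠ 0 ∧ f z = 0) :
    DifferentiableOn ℂ (fun z => if s z = 0 then deriv f z / deriv s z else f z / s z) U ∧
      ∀ z ∈ U, f z = s z * (if s z = 0 then deriv f z / deriv s z else f z / s z) := by
  constructor
  · intro p hp
    apply DifferentiableAt.differentiableWithinAt
    have hUp : U ∈ nhds p := hU.mem_nhds hp
    by_cases hsp : s p = 0
    · obtain ⟨hd, hfp⟩ := h p hp hsp
      have hdf := (Complex.differentiableOn_dslope (c := p) hUp).2 hf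
      have hds := (Complex.differentiableOn_dslope (c := p) hUp).2 hs
      have hdfp := hdf.differentiableAt hUp
      have hdsp := hds.differentiableAt hUp
      have hne : dslope s p p ≠ 0 := by rwa [dslope_same]
      refine (hdfp.div hdsp hne).congr_of_eventuallyEq ?_
      filter_upwards [hdsp.continuousAt.eventually_ne hne] with z hz
      by_cases hzp : z = p
      · subst hzp; simp [hsp, dslope_same]
      · have e1 : (z - p) * dslope s p z = s z := by
          have := sub_smul_dslope s p z
          simpa [hsp] using this
        have e2 : (z - p) * dslope f p z = f z := by
          have := sub_smul_dslope f p z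
          simpa [hfp] using this
        have hzp' : z - p ≠ 0 := sub_ne_zero.2 hzp
        have : s z ≠ 0 := by rw [← e1]; exact mul_ne_zero hzp' hz
        simp only [this, if_false, Pi.div_apply]
        rw [← e1, ← e2, mul_div_mul_left _ _ hzp']
    · have hsa := hs.differentiableAt hUp
      refine ((hf.differentiableAt hUp).div hsa hsp).congr_of_eventuallyEq ?_
      filter_upwards [hsa.continuousAt.eventually_ne hsp] with z hz
      simp [hz]
  · intro z hz
    by_cases hsz : s z = 0
    · simp [hsz, (h z hz hsz).2]
    · simp only [hsz, if_false]; field_simp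

theorem eqOn_of_mul_eq {U : Set ℂ} (hU : IsOpen U) {f g s : ℂ → ℂ}
    (hs : ∀ z ∈ U, ∃ s' : ℂ, s' ≠ 0 ∧ HasDerivAt s s' z)
    (hf : ContinuousOn f U) (hg : ContinuousOn g U)
    (h : ∀ z ∈ U, s z * f z = s z * g z) : ∀ z ∈ U, f z = g z := by
  intro z hz
  obtain ⟨s', hs', hder⟩ := hs z hz
  have hUz := hU.mem_nhds hz
  have h1 : Tendsto f (nhdsWithin z {z}ᶜ) (nhds (f z)) :=
    (hf.continuousAt hUz).tendsto.mono_left nhdsWithin_le_nhds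
  have h2 : Tendsto g (nhdsWithin z {z}ᶜ) (nhds (g z)) :=
    (hg.continuousAt hUz).tendsto.mono_left nhdsWithin_le_nhds
  refine tendsto_nhds_unique (h1.congr' ?_) h2
  filter_upwards [hder.eventually_ne (c := 0) hs', mem_nhdsWithin_of_mem_nhds hUz] with x hx hxU
  exact mul_left_cancel₀ hx (h x hxU)

theorem norm_one_sub_conj_mul_sq_sub (p z : ℂ) :
    ‖1 - (starRingEnd ℂ) p * z‖ ^ 2 - ‖z - p‖ ^ 2 = (1 - ‖p‖ ^ 2) * (1 - ‖z‖ ^ 2) := by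
  simp only [Complex.sq_norm, Complex.normSq_apply, Complex.sub_re, Complex.sub_im,
    Complex.mul_re, Complex.mul_im, Complex.one_re, Complex.one_im, Complex.conj_re,
    Complex.conj_im]
  ring

theorem one_sub_conj_mul_ne_zero {p z : ℂ} (hp : ‖p‖ < 1) (hz : ‖z‖ < 1) :
    1 - (starRingEnd ℂ) p * z ≠ 0 := by
  intro h
  have h1 : (starRingEnd ℂ) p * z = 1 := (sub_eq_zero.1 h).symm
  have h2 : ‖p‖ * ‖z‖ = 1 := by
    rw [← Complex.norm_conj p, ← norm_mul, h1, norm_one]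
  nlinarith [norm_nonneg p, norm_nonneg z]

theorem norm_mobius_lt_one {p z : ℂ} (hp : ‖p‖ < 1) (hz : ‖z‖ < 1) :
    ‖(z - p) / (1 - (starRingEnd ℂ) p * z)‖ < 1 := by
  have hne := one_sub_conj_mul_ne_zero hp hz
  rw [norm_div, div_lt_one (norm_pos_iff.2 hne)]
  refine lt_of_pow_lt_pow_left₀ 2 (norm_nonneg _) ?_
  have h := norm_one_sub_conj_mul_sq_sub p z
  have h1 : 0 < 1 - ‖p‖ ^ 2 := by nlinarith [norm_nonneg p]
  have h2 : 0 < 1 - ‖z‖ ^ 2 := by nlinarith [norm_nonneg z]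
  nlinarith [mul_pos h1 h2]

/-- Dividing a bounded holomorphic function on the unit disc by the Blaschke factor of one of its
zeros does not increase the bound. -/
theorem exists_blaschke_quotient {f : ℂ → ℂ} {M : ℝ} {p : ℂ}
    (hf : DifferentiableOn ℂ f (Metric.ball 0 1)) (hM : ∀ z ∈ Metric.ball (0 : ℂ) 1, ‖f z‖ ≤ M)
    (hp : ‖p‖ < 1) (hfp : f p = 0) :
    ∃ e : ℂ → ℂ, DifferentiableOn ℂ e (Metric.ball 0 1) ∧
      (∀ z ∈ Metric.ball (0 : ℂ) 1, ‖e z‖ ≤ M) ∧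
      ∀ z, f z * (1 - (starRingEnd ℂ) p * z) = (z - p) * e z := by
  have hpb : p ∈ Metric.ball (0 : ℂ) 1 := by simpa using hp
  have hnhds : Metric.ball (0 : ℂ) 1 ∈ nhds p := Metric.isOpen_ball.mem_nhds hpb
  have hdiff : DifferentiableOn ℂ (fun z => (1 - (starRingEnd ℂ) p * z) * dslope f p z)
      (Metric.ball 0 1) := by
    refine DifferentiableOn.mul (by fun_prop) ((Complex.differentiableOn_dslope hnhds).2 hf)
  have heq : ∀ z, f z * (1 - (starRingEnd ℂ) p * z)
      = (z - p) * ((1 - (starRingEnd ℂ) p * z) * dslope f p z) := by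
    intro z
    have e2 : (z - p) * dslope f p z = f z := by
      have := sub_smul_dslope f p z
      simpa [hfp] using this
    rw [← e2]; ring
  have hoff : ∀ z ∈ Metric.ball (0 : ℂ) 1, z ≠ p →
      ‖(1 - (starRingEnd ℂ) p * z) * dslope f p z‖ ≤ M := by
    intro z hz hzp
    have hz1 : ‖z‖ < 1 := by simpa using hz
    have hp' : ‖-p‖ < 1 := by simpa using hp
    have hne : ∀ x : ℂ, ‖x‖ < 1 → 1 - (starRingEnd ℂ) (-p) * x ≠ 0 := fun x hx =>
      one_sub_conj_mul_ne_zero hp' hx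
    have hmob : ∀ x ∈ Metric.ball (0 : ℂ) 1,
        (x - -p) / (1 - (starRingEnd ℂ) (-p) * x) ∈ Metric.ball (0 : ℂ) 1 := by
      intro x hx
      have := norm_mobius_lt_one hp' (z := x) (by simpa using hx)
      simpa using this
    set ζ := (z - p) / (1 - (starRingEnd ℂ) p * z) with hζ
    have hζ1 : ‖ζ‖ < 1 := norm_mobius_lt_one hp hz1
    have hzne := one_sub_conj_mul_ne_zero hp hz1
    have hback : (ζ - -p) / (1 - (starRingEnd ℂ) (-p) * ζ) = z := by
      rw [div_eq_iff (hne ζ hζ1), hζ]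
      simp only [map_neg]
      refine mul_right_cancel₀ hzne ?_
      rw [neg_mul, sub_neg_eq_add, sub_neg_eq_add, add_mul, div_mul_cancel₀ _ hzne, mul_assoc z,
        add_mul, mul_assoc _ _ (1 - (starRingEnd ℂ) p * z), div_mul_cancel₀ _ hzne]
      ring
    have hg : DifferentiableOn ℂ (fun x => f ((x - -p) / (1 - (starRingEnd ℂ) (-p) * x)))
        (Metric.ball 0 1) := by
      refine hf.comp (t := Metric.ball 0 1) ?_ hmob
      refine DifferentiableOn.div (by fun_prop) (by fun_prop) ?_
      intro x hx
      exact hne x (by simpa using hx)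
    have h0 : f ((0 - -p) / (1 - (starRingEnd ℂ) (-p) * 0)) = 0 := by simpa using hfp
    have hsch := Complex.dist_le_div_mul_dist_of_mapsTo_ball (R₂ := M) (z := ζ) hg
      (by
        intro x hx
        simp only [h0, Metric.mem_closedBall, dist_zero_right]
        exact hM _ (hmob x hx)) (by simpa using hζ1)
    simp only [hback, h0, dist_zero_right, div_one] at hsch
    have hzp' : 0 < ‖z - p‖ := norm_pos_iff.2 (sub_ne_zero.2 hzp)
    have hn := congrArg norm (heq z)
    rw [norm_mul, norm_mul (z - p)] at hn
    rw [hζ, norm_div, mul_div_assoc', le_div_iff₀ (norm_pos_iff.2 hzne), hn] at hsch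
    nlinarith
  refine ⟨_, hdiff, ?_, heq⟩
  intro z hz
  by_cases hzp : z = p
  · subst hzp
    have hc := (hdiff.continuousOn.continuousAt hnhds).norm
    have ht : Tendsto _ (nhdsWithin z {z}ᶜ) _ := hc.tendsto.mono_left nhdsWithin_le_nhds
    refine le_of_tendsto ht ?_
    filter_upwards [self_mem_nhdsWithin, mem_nhdsWithin_of_mem_nhds hnhds] with x hx hxU
    exact hoff x hxU hx
  · exact hoff z hz hzp

/-- Lower bound of Harnack type for zero-free bounded holomorphic functions on a disc. -/
theorem rpow_le_norm_of_ne_zero {F : ℂ → ℂ} {r R δ : ℝ} (hr : 0 ≤ r) (hrR : r < R)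
    (hδ : 0 < δ) (hδ1 : δ < 1)
    (hF : DifferentiableOn ℂ F (Metric.ball 0 R)) (hF1 : ∀ z ∈ Metric.ball (0 : ℂ) R, ‖F z‖ ≤ 1)
    (hF0 : ∀ z ∈ Metric.ball (0 : ℂ) R, F z ≠ 0) (hδF : δ ≤ ‖F 0‖) :
    ∀ z : ℂ, ‖z‖ ≤ r → δ ^ (1 + 2 * r / (R - r)) ≤ ‖F z‖ := by
  have hR : 0 < R := hr.trans_lt hrR
  have h0 : (0 : ℂ) ∈ Metric.ball (0 : ℂ) R := by simpa using hR
  have hexact : Complex.IsExactOn (fun z => deriv F z / F z) (Metric.ball 0 R) := by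
    apply DifferentiableOn.isExactOn_ball
    exact (hF.deriv Metric.isOpen_ball).div hF hF0
  obtain ⟨g, hg0, hg⟩ := hexact.with_val_at 0 (Complex.log (F 0))
  have hconst : ∀ z ∈ Metric.ball (0 : ℂ) R, F z * Complex.exp (-g z) = 1 := by
    intro z hz
    have hder : ∀ x ∈ Metric.ball (0 : ℂ) R,
        HasDerivAt (fun z => F z * Complex.exp (-g z)) 0 x := by
      intro x hx
      have h1 := (hF.differentiableAt (Metric.isOpen_ball.mem_nhds hx)).hasDerivAt
      have h2 := (hg x hx).fun_neg.cexp
      refine (h1.mul h2).congr_deriv ?_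
      field_simp [hF0 x hx]
      ring
    have := Metric.isOpen_ball.is_const_of_deriv_eq_zero
      (convex_ball (0 : ℂ) R).isPreconnected
      (fun x hx => (hder x hx).differentiableAt.differentiableWithinAt)
      (fun x hx => (hder x hx).deriv) hz h0
    rw [this, hg0, Complex.exp_neg, Complex.exp_log (hF0 0 h0), mul_inv_cancel₀ (hF0 0 h0)]
  have hFg : ∀ z ∈ Metric.ball (0 : ℂ) R, F z = Complex.exp (g z) := by
    intro z hz
    have h := hconst z hz
    rw [Complex.exp_neg] at h
    field_simp at h
    exact h
  have hlog : 0 < -Real.log δ := by linarith [Real.log_neg hδ hδ1]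
  have hre : ∀ z ∈ Metric.ball (0 : ℂ) R, (g z).re ≤ 0 := by
    intro z hz
    have := hF1 z hz
    rwa [hFg z hz, Complex.norm_exp, Real.exp_le_one_iff] at this
  have hre0 : Real.log δ ≤ (g 0).re := by
    rw [hFg 0 h0, Complex.norm_exp] at hδF
    exact (Real.log_le_iff_le_exp hδ).2 hδF
  intro z hz
  have hzR : ‖z‖ < R := hz.trans_lt hrR
  have hzb : z ∈ Metric.ball (0 : ℂ) R := by simpa using hzR
  have hbc := Complex.borelCaratheodory_zero (f := fun z => g z - g 0) (M := -Real.log δ) hlog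
    (fun x hx => ((hg x hx).differentiableAt.sub_const _).differentiableWithinAt)
    (by
      intro x hx
      have := hre x hx
      simp only [Set.mem_ofPred_eq, Complex.sub_re]
      linarith) hR hzb (by simp)
  have h1 : -(g z - g 0).re ≤ ‖g z - g 0‖ := (neg_le_abs _).trans (Complex.abs_re_le_norm _)
  have h2 : 2 * -Real.log δ * ‖z‖ / (R - ‖z‖) ≤ 2 * -Real.log δ * r / (R - r) := by
    have : 0 < R - r := by linarith
    gcongr
  rw [hFg z hzb, Complex.norm_exp, Real.rpow_def_of_pos hδ, Real.exp_le_exp]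
  simp only [Complex.sub_re] at h1
  have h3 : Real.log δ * (1 + 2 * r / (R - r)) = Real.log δ - 2 * -Real.log δ * r / (R - r) := by
    ring
  linarith

/-- A holomorphic quotient of bounded functions on the unit disc is controlled on smaller discs by
the size of the denominator at the centre. -/
theorem norm_le_of_mul_bounded {r R M : ℝ} (hr : 0 ≤ r) (hrR : r < R) (hR : R < 1) (n : ℕ) :
    ∀ (δ : ℝ) (F H : ℂ → ℂ), 0 < δ → R ^ n < δ → DifferentiableOn ℂ F (Metric.ball 0 1) →
      DifferentiableOn ℂ H (Metric.ball 0 1) → (∀ z ∈ Metric.ball (0 : ℂ) 1, ‖F z‖ ≤ 1) →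
      (∀ z ∈ Metric.ball (0 : ℂ) 1, ‖F z * H z‖ ≤ M) → δ ≤ ‖F 0‖ → δ < 1 →
      ∀ z : ℂ, ‖z‖ ≤ r → ‖H z‖ ≤ M * δ ^ (-(1 + 2 * r / (R - r))) := by
  have hR0 : 0 < R := hr.trans_lt hrR
  have hRr : 0 < R - r := by linarith
  induction n with
  | zero =>
    intro δ F H hδ hn hF hH hF1 hFH hδF hδ1
    simp only [pow_zero] at hn
    linarith
  | succ n ih =>
    intro δ F H hδ hn hF hH hF1 hFH hδF hδ1 z hz
    have hzb : z ∈ Metric.ball (0 : ℂ) 1 := by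
      simpa using (hz.trans_lt hrR).trans hR
    have hM : 0 ≤ M := (norm_nonneg _).trans (hFH z hzb)
    by_cases hzero : ∀ z ∈ Metric.ball (0 : ℂ) R, F z ≠ 0
    · have hsub : Metric.ball (0 : ℂ) R ⊆ Metric.ball 0 1 := Metric.ball_subset_ball hR.le
      have hlow := rpow_le_norm_of_ne_zero hr hrR hδ hδ1 (hF.mono hsub)
        (fun x hx => hF1 x (hsub hx)) hzero hδF z hz
      have hpos : 0 < δ ^ (1 + 2 * r / (R - r)) := Real.rpow_pos_of_pos hδ _
      rw [Real.rpow_neg hδ.le, ← div_eq_mul_inv, le_div_iff₀ hpos]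
      have := hFH z hzb
      rw [norm_mul] at this
      nlinarith [norm_nonneg (H z)]
    · push Not at hzero
      obtain ⟨p, hpR, hp0⟩ := hzero
      have hpR' : ‖p‖ < R := by simpa using hpR
      have hp1 : ‖p‖ < 1 := hpR'.trans hR
      obtain ⟨e, he, he1, hee⟩ := exists_blaschke_quotient hF hF1 hp1 hp0
      obtain ⟨k, hk, hk1, hkk⟩ := exists_blaschke_quotient (f := fun z => F z * H z) (hF.mul hH)
        hFH hp1 (by simp [hp0])
      have hke : ∀ x ∈ Metric.ball (0 : ℂ) 1, k x = e x * H x := by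
        refine eqOn_of_mul_eq Metric.isOpen_ball
          (fun z _ => ⟨1, one_ne_zero, (hasDerivAt_id z).sub_const p⟩) hk.continuousOn
          (he.mul hH).continuousOn ?_
        intro x _
        simp only [id]
        rw [← hkk x]
        linear_combination (H x) * hee x
      have h0 : ‖F 0‖ = ‖p‖ * ‖e 0‖ := by
        have := congrArg norm (hee 0)
        simpa using this
      have he0 : δ / R ≤ ‖e 0‖ := by
        rw [div_le_iff₀ hR0]
        nlinarith [norm_nonneg (e 0)]
      have hle : δ ≤ δ / R := by
        rw [le_div_iff₀ hR0]; nlinarith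
      have hnn : R ^ n < δ / R := by
        rw [lt_div_iff₀ hR0, ← pow_succ]; exact hn
      have heH : ∀ x ∈ Metric.ball (0 : ℂ) 1, ‖e x * H x‖ ≤ M :=
        fun x hx => hke x hx ▸ hk1 x hx
      have hexp : -(1 + 2 * r / (R - r)) ≤ 0 := by
        have : 0 ≤ 2 * r / (R - r) := by positivity
        linarith
      have hcase : ∃ δ', δ ≤ δ' ∧ R ^ n < δ' ∧ δ' ≤ ‖e 0‖ ∧ δ' < 1 := by
        rcases lt_or_ge (δ / R) 1 with hlt | hge
        · exact ⟨δ / R, hle, hnn, he0, hlt⟩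
        · have he01 : ‖e 0‖ ≤ 1 := he1 0 (by simp)
          have hn0 : n ≠ 0 := by
            rintro rfl
            simp only [pow_zero] at hnn
            linarith
          have hRn : R ^ n < 1 := pow_lt_one₀ hR0.le hR hn0
          obtain ⟨δ', h1, h2⟩ := exists_between (max_lt hδ1 hRn)
          exact ⟨δ', (le_max_left _ _).trans h1.le, (le_max_right _ _).trans_lt h1,
            h2.le.trans (hge.trans he0), h2⟩
      obtain ⟨δ', h1, h2, h3, h4⟩ := hcase
      refine (ih δ' e H (hδ.trans_le h1) h2 he hH he1 heH h3 h4 z hz).trans ?_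
      exact mul_le_mul_of_nonneg_left (Real.rpow_le_rpow_of_nonpos hδ h1 hexp) hM

theorem isOpen_strip (η : ℝ) : IsOpen (Strip η) :=
  isOpen_lt (continuous_abs.comp Complex.continuous_im) continuous_const

/-- A Riemann map from a strip to the unit disc, together with its inverse. -/
theorem exists_strip_uniformization {η : ℝ} (hη : 0 < η) :
    ∃ φ T : ℂ → ℂ, DifferentiableOn ℂ T (Strip η) ∧
      (∀ z ∈ Strip η, T z ∈ Metric.ball (0 : ℂ) 1) ∧
      DifferentiableOn ℂ φ (Metric.ball 0 1) ∧
      (∀ z ∈ Metric.ball (0 : ℂ) 1, φ z ∈ Strip η) ∧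
      (∀ z ∈ Strip η, φ (T z) = z) ∧ T 0 = 0 := by
  set κ : ℝ := π / (2 * η) with hκ
  have hκ0 : 0 < κ := by positivity
  have hκη : κ * η = π / 2 := by rw [hκ]; field_simp
  have hκC : (κ : ℂ) ≠ 0 := by exact_mod_cast hκ0.ne'
  have him : ∀ z ∈ Strip η, |((κ : ℂ) * z).im| < π / 2 := by
    intro z hz
    have hz' : |z.im| < η := hz
    rw [Complex.im_ofReal_mul, abs_mul, abs_of_pos hκ0, ← hκη]
    exact mul_lt_mul_of_pos_left hz' hκ0
  have hre : ∀ z ∈ Strip η, 0 < (Complex.exp (κ * z)).re := by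
    intro z hz
    have h := abs_lt.1 (him z hz)
    rw [Complex.exp_re]
    exact mul_pos (Real.exp_pos _) (Real.cos_pos_of_mem_Ioo ⟨by linarith [h.1], h.2⟩)
  have hne : ∀ z ∈ Strip η, Complex.exp (κ * z) + 1 ≠ 0 := by
    intro z hz h
    have := congrArg Complex.re h
    simp only [Complex.add_re, Complex.one_re, Complex.zero_re] at this
    linarith [hre z hz]
  have hone : ∀ z ∈ Metric.ball (0 : ℂ) 1, 1 - z ≠ 0 := by
    intro z hz h
    have hz1 : z = 1 := (sub_eq_zero.1 h).symm
    simp [hz1] at hz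
  have hposre : ∀ z ∈ Metric.ball (0 : ℂ) 1, 0 < ((1 + z) / (1 - z)).re := by
    intro z hz
    have hz1 : ‖z‖ < 1 := by simpa using hz
    have hn : 0 < Complex.normSq (1 - z) := Complex.normSq_pos.2 (hone z hz)
    have hsq : z.re * z.re + z.im * z.im < 1 := by
      have := Complex.sq_norm z
      rw [Complex.normSq_apply] at this
      nlinarith [norm_nonneg z]
    rw [Complex.div_re, ← add_div]
    apply div_pos _ hn
    simp only [Complex.add_re, Complex.one_re, Complex.sub_re, Complex.add_im, Complex.one_im,
      Complex.sub_im]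
    nlinarith
  refine ⟨fun z => Complex.log ((1 + z) / (1 - z)) / κ,
    fun z => (Complex.exp (κ * z) - 1) / (Complex.exp (κ * z) + 1), ?_, ?_, ?_, ?_, ?_, ?_⟩
  · exact DifferentiableOn.div (by fun_prop) (by fun_prop) hne
  · intro z hz
    have hw := hre z hz
    have hw1 := norm_pos_iff.2 (hne z hz)
    rw [mem_ball_zero_iff, norm_div, div_lt_one hw1]
    refine lt_of_pow_lt_pow_left₀ 2 (norm_nonneg _) ?_
    simp only [Complex.sq_norm, Complex.normSq_apply, Complex.sub_re, Complex.sub_im,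
      Complex.add_re, Complex.add_im, Complex.one_re, Complex.one_im]
    nlinarith
  · refine DifferentiableOn.div_const (DifferentiableOn.clog ?_ ?_) _
    · exact DifferentiableOn.div (by fun_prop) (by fun_prop) hone
    · intro z hz
      exact Or.inl (hposre z hz)
  · intro z hz
    have h := Complex.abs_arg_lt_pi_div_two_iff.2 (Or.inl (hposre z hz))
    change |(Complex.log ((1 + z) / (1 - z)) / (κ : ℂ)).im| < η
    rw [Complex.div_ofReal_im, Complex.log_im, abs_div, abs_of_pos hκ0, div_lt_iff₀ hκ0,
      mul_comm, hκη]
    exact h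
  · intro z hz
    have h1 := hne z hz
    have h2 : (1 + (Complex.exp (κ * z) - 1) / (Complex.exp (κ * z) + 1)) /
        (1 - (Complex.exp (κ * z) - 1) / (Complex.exp (κ * z) + 1)) = Complex.exp (κ * z) := by
      have h3 : 1 + (Complex.exp (κ * z) - 1) / (Complex.exp (κ * z) + 1)
          = 2 * Complex.exp (κ * z) / (Complex.exp (κ * z) + 1) := by
        rw [eq_div_iff h1, add_mul, div_mul_cancel₀ _ h1]; ring
      have h4 : 1 - (Complex.exp (κ * z) - 1) / (Complex.exp (κ * z) + 1)
          = 2 / (Complex.exp (κ * z) + 1) := by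
        rw [eq_div_iff h1, sub_mul, div_mul_cancel₀ _ h1]; ring
      rw [h3, h4, div_div_div_cancel_right₀ h1]
      field_simp
    have h := abs_lt.1 (him z hz)
    simp only [h2]
    rw [Complex.log_exp (by linarith [h.1, Real.pi_pos]) (by linarith [h.2, Real.pi_pos])]
    field_simp
  · simp

/-- The `1`-periodic entire function with simple zeros exactly at the integers. -/
def expSubOne (z : ℂ) : ℂ := Complex.exp (2 * π * Complex.I * z) - 1

theorem hasDerivAt_expSubOne (z : ℂ) : HasDerivAt expSubOne
    (2 * π * Complex.I * Complex.exp (2 * π * Complex.I * z)) z := by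
  have h := (((hasDerivAt_id z).const_mul (2 * π * Complex.I)).cexp).sub_const 1
  refine h.congr_deriv ?_
  simp only [id, mul_one]
  ring

@[fun_prop]
theorem differentiable_expSubOne : Differentiable ℂ expSubOne :=
  fun z => (hasDerivAt_expSubOne z).differentiableAt

theorem deriv_expSubOne_ne_zero (z : ℂ) : deriv expSubOne z ≠ 0 := by
  rw [(hasDerivAt_expSubOne z).deriv]
  exact mul_ne_zero Complex.two_pi_I_ne_zero (Complex.exp_ne_zero _)

theorem expSubOne_add_one (z : ℂ) : expSubOne (z + 1) = expSubOne z := by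
  simp only [expSubOne, mul_add, mul_one, Complex.exp_add, Complex.exp_two_pi_mul_I]

theorem expSubOne_zero : expSubOne 0 = 0 := by simp [expSubOne]

theorem expSubOne_eq_zero_iff {z : ℂ} : expSubOne z = 0 ↔ ∃ n : ℤ, z = n := by
  rw [expSubOne, sub_eq_zero, Complex.exp_eq_one_iff]
  refine exists_congr fun n => ?_
  rw [mul_comm (n : ℂ), mul_right_inj' Complex.two_pi_I_ne_zero]

theorem norm_expSubOne_le {z : ℂ} {t : ℝ} (h : |z.im| ≤ t) :
    ‖expSubOne z‖ ≤ Real.exp (2 * π * t) + 1 := by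
  refine (norm_sub_le _ _).trans ?_
  rw [norm_one, Complex.norm_exp]
  have h1 : (2 * π * Complex.I * z).re = 2 * π * (-z.im) := by simp
  rw [h1]
  have := (neg_le_abs z.im).trans h
  gcongr

/-- The product of the translates of `expSubOne` with zeros at the points of a list. -/
def periodicProd (l : List ℂ) (z : ℂ) : ℂ := (l.map fun p => expSubOne (z - p)).prod

@[simp]
theorem periodicProd_nil (z : ℂ) : periodicProd [] z = 1 := rfl

@[simp]
theorem periodicProd_cons (p : ℂ) (l : List ℂ) (z : ℂ) :
    periodicProd (p :: l) z = expSubOne (z - p) * periodicProd l z := by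
  simp [periodicProd]

@[fun_prop]
theorem differentiable_periodicProd (l : List ℂ) : Differentiable ℂ (periodicProd l) := by
  induction l with
  | nil => exact differentiable_const 1
  | cons p l ih =>
    have : periodicProd (p :: l) = fun z => expSubOne (z - p) * periodicProd l z :=
      funext (periodicProd_cons p l)
    rw [this]
    fun_prop

/-- The part of the strip of half-width `ε` lying over a period interval centred at `0`. -/
def stripBox (ε : ℝ) : Set ℂ := Set.Icc (-(1 / 2)) (1 / 2) ×ℂ Set.Icc (-ε) ε

theorem isCompact_stripBox (ε : ℝ) : IsCompact (stripBox ε) :=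
  isCompact_Icc.reProdIm isCompact_Icc

theorem stripBox_subset {ε η : ℝ} (h : ε < η) : stripBox ε ⊆ Strip η := by
  intro z hz
  exact (abs_le.2 (Complex.mem_reProdIm.1 hz).2).trans_lt h

theorem zero_mem_stripBox {ε : ℝ} (hε : 0 ≤ ε) : (0 : ℂ) ∈ stripBox ε := by
  refine Complex.mem_reProdIm.2 ⟨?_, ?_⟩ <;> simp [hε]

theorem norm_periodicProd_le {η : ℝ} {l : List ℂ} (hl : ∀ p ∈ l, p ∈ Strip η) {z : ℂ}
    (hz : z ∈ Strip η) :
    ‖periodicProd l z‖ ≤ (Real.exp (2 * π * (2 * η)) + 1) ^ l.length := by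
  induction l with
  | nil => simp
  | cons p l ih =>
    rw [periodicProd_cons, norm_mul, List.length_cons, pow_succ']
    have hp : |p.im| < η := hl p (by simp)
    have hz' : |z.im| < η := hz
    have h1 : |(z - p).im| ≤ 2 * η := by
      rw [Complex.sub_im]
      linarith [abs_sub z.im p.im]
    gcongr
    · exact norm_expSubOne_le h1
    · exact ih fun q hq => hl q (by simp [hq])

/-- A function on a strip bounded by `1` is bounded at `0` by the product of the Blaschke factors
of the zeros prescribed by a divisor. -/
theorem norm_le_prod_of_eq_periodicProd_mul {η : ℝ} {φ T : ℂ → ℂ}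
    (hT : ∀ z ∈ Strip η, T z ∈ Metric.ball (0 : ℂ) 1)
    (hφ : DifferentiableOn ℂ φ (Metric.ball 0 1)) (hφT : ∀ z ∈ Strip η, φ (T z) = z)
    (l : List ℂ) : (∀ p ∈ l, p ∈ Strip η) → ∀ e w : ℂ → ℂ,
      DifferentiableOn ℂ e (Metric.ball 0 1) → DifferentiableOn ℂ w (Metric.ball 0 1) →
      (∀ z ∈ Metric.ball (0 : ℂ) 1, ‖e z‖ ≤ 1) →
      (∀ z ∈ Metric.ball (0 : ℂ) 1, e z = periodicProd l (φ z) * w z) →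
      ‖e 0‖ ≤ (l.map fun p => ‖T p‖).prod := by
  induction l with
  | nil =>
    intro _ e w _ _ he1 _
    simpa using he1 0 (by simp)
  | cons p l ih =>
    intro hl e w he hw he1 hew
    have hp : p ∈ Strip η := hl p (by simp)
    have hqb := hT p hp
    have hq1 : ‖T p‖ < 1 := by simpa using hqb
    have hS : DifferentiableOn ℂ (fun z => expSubOne (φ z - p)) (Metric.ball 0 1) :=
      differentiable_expSubOne.comp_differentiableOn (hφ.sub_const p)
    have hS0 : expSubOne (φ (T p) - p) = 0 := by rw [hφT p hp, sub_self, expSubOne_zero]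
    have heq : e (T p) = 0 := by rw [hew _ hqb, periodicProd_cons, hS0, zero_mul, zero_mul]
    obtain ⟨k, hk, hk1, hke⟩ := exists_blaschke_quotient he he1 hq1 heq
    have hdS := (Complex.differentiableOn_dslope (Metric.isOpen_ball.mem_nhds hqb)).2 hS
    have hw' : DifferentiableOn ℂ (fun z => (1 - (starRingEnd ℂ) (T p) * z) *
        dslope (fun z => expSubOne (φ z - p)) (T p) z * w z) (Metric.ball 0 1) :=
      DifferentiableOn.mul (DifferentiableOn.mul (by fun_prop) hdS) hw
    have hprod : DifferentiableOn ℂ (fun z => periodicProd l (φ z)) (Metric.ball 0 1) :=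
      (differentiable_periodicProd l).comp_differentiableOn hφ
    have hkw := eqOn_of_mul_eq Metric.isOpen_ball
      (fun z _ => ⟨1, one_ne_zero, (hasDerivAt_id z).sub_const (T p)⟩) hk.continuousOn
      (hprod.mul hw').continuousOn (by
        intro z hz
        have e1 : (z - T p) * dslope (fun z => expSubOne (φ z - p)) (T p) z
            = expSubOne (φ z - p) := by
          have := sub_smul_dslope (fun z => expSubOne (φ z - p)) (T p) z
          simpa [hS0] using this
        simp only [id]
        rw [← hke z, hew z hz, periodicProd_cons, ← e1]
        simp only [Pi.mul_apply]
        ring)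
    have h0 : ‖e 0‖ = ‖T p‖ * ‖k 0‖ := by
      have := congrArg norm (hke 0)
      simpa using this
    rw [h0, List.map_cons, List.prod_cons]
    gcongr
    exact ih (fun q hq => hl q (by simp [hq])) k _ hk hw' hk1 hkw

theorem exists_norm_le_mul_norm_expSubOne {ε η : ℝ} (hεη : ε < η) {T : ℂ → ℂ}
    (hT : DifferentiableOn ℂ T (Strip η)) (hT0 : T 0 = 0) :
    ∃ M : ℝ, 0 < M ∧ ∀ z ∈ stripBox ε, ‖T z‖ ≤ M * ‖expSubOne (0 - z)‖ := by
  set U : Set ℂ := Strip η ∩ {z : ℂ | |z.re| < 1} with hUdef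
  have hU : IsOpen U := (isOpen_strip η).inter
    (isOpen_lt (continuous_abs.comp Complex.continuous_re) continuous_const)
  have hbox : stripBox ε ⊆ U := by
    intro z hz
    refine ⟨stripBox_subset hεη hz, ?_⟩
    have := abs_le.2 (Complex.mem_reProdIm.1 hz).1
    change |z.re| < 1
    linarith
  have hs : Differentiable ℂ (fun z : ℂ => expSubOne (0 - z)) := by fun_prop
  obtain ⟨hq, hqe⟩ := exists_holomorphic_quotient hU (f := T) (s := fun z => expSubOne (0 - z))
    (hT.mono Set.inter_subset_left) hs.differentiableOn (by
      intro z hz hz0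
      constructor
      · have h : HasDerivAt (fun z : ℂ => expSubOne (0 - z)) _ z :=
          ((hasDerivAt_expSubOne (0 - z)).comp z ((hasDerivAt_id z).const_sub 0))
        rw [h.deriv]
        simp
      · obtain ⟨n, hn⟩ := expSubOne_eq_zero_iff.1 hz0
        have hzn : z = ((-n : ℤ) : ℂ) := by push_cast; rw [← hn]; ring
        have hre : |z.re| < 1 := hz.2
        rw [hzn, Complex.intCast_re] at hre
        have h0 : (-n : ℤ) = 0 := Int.abs_lt_one_iff.1 (by exact_mod_cast hre)
        rw [hzn, h0, Int.cast_zero, hT0])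
  obtain ⟨M, hM⟩ := (isCompact_stripBox ε).exists_bound_of_continuousOn
    (hq.continuousOn.mono hbox)
  refine ⟨max M 1, lt_max_of_lt_right one_pos, fun z hz => ?_⟩
  rw [hqe z (hbox hz), norm_mul, mul_comm]
  gcongr
  exact (hM z hz).trans (le_max_left _ _)

theorem exists_norm_lt_one_on_stripBox {ε η : ℝ} (hε : 0 ≤ ε) (hεη : ε < η) {T : ℂ → ℂ}
    (hT : DifferentiableOn ℂ T (Strip η)) (hTb : ∀ z ∈ Strip η, T z ∈ Metric.ball (0 : ℂ) 1) :
    ∃ r : ℝ, 0 < r ∧ r < 1 ∧ ∀ z ∈ stripBox ε, ‖T z‖ ≤ r := by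
  obtain ⟨z, hz, hmax⟩ := (isCompact_stripBox ε).exists_isMaxOn ⟨0, zero_mem_stripBox hε⟩
    (hT.continuousOn.mono (stripBox_subset hεη)).norm
  have h1 : ‖T z‖ < 1 := by simpa using hTb z (stripBox_subset hεη hz)
  obtain ⟨r, hr, hr1⟩ := exists_between h1
  exact ⟨r, (norm_nonneg _).trans_lt hr, hr1, fun x hx => (hmax hx).trans hr.le⟩

/-- Quantitative control of the zeros in a substrip of a function bounded by `1`. -/
theorem exists_zero_count_bound {ε η : ℝ} (hε : 0 ≤ ε) (hεη : ε < η) :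
    ∃ r c : ℝ, 0 < r ∧ r < 1 ∧ 0 < c ∧ ∀ (l : List ℂ) (f w : ℂ → ℂ), (∀ p ∈ l, p ∈ stripBox ε) →
      DifferentiableOn ℂ f (Strip η) → DifferentiableOn ℂ w (Strip η) →
      (∀ z ∈ Strip η, ‖f z‖ ≤ 1) → (∀ z ∈ Strip η, f z = periodicProd l z * w z) →
      ‖f 0‖ ≤ r ^ l.length ∧ c ^ l.length * ‖f 0‖ ≤ ‖periodicProd l 0‖ := by
  obtain ⟨φ, T, hT, hTb, hφ, hφS, hφT, hT0⟩ := exists_strip_uniformization (hε.trans_lt hεη)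
  obtain ⟨M, hM, hMT⟩ := exists_norm_le_mul_norm_expSubOne hεη hT hT0
  obtain ⟨r, hr, hr1, hrT⟩ := exists_norm_lt_one_on_stripBox hε hεη hT hTb
  refine ⟨r, M⁻¹, hr, hr1, inv_pos.2 hM, ?_⟩
  intro l f w hl hf hw hf1 hfw
  have h0S : (0 : ℂ) ∈ Strip η := stripBox_subset hεη (zero_mem_stripBox hε)
  have hφ0 : φ 0 = 0 := by simpa [hT0] using hφT 0 h0S
  have hprod := norm_le_prod_of_eq_periodicProd_mul hTb hφ hφT l
    (fun p hp => stripBox_subset hεη (hl p hp)) (fun z => f (φ z)) (fun z => w (φ z))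
    (hf.comp hφ hφS) (hw.comp hφ hφS) (fun z hz => hf1 _ (hφS z hz))
    (fun z hz => hfw _ (hφS z hz))
  simp only [hφ0] at hprod
  refine ⟨hprod.trans ?_, ?_⟩
  · clear hfw hprod
    induction l with
    | nil => simp
    | cons p l ih =>
      rw [List.map_cons, List.prod_cons, List.length_cons, pow_succ']
      exact mul_le_mul (hrT p (hl p (by simp))) (ih fun q hq => hl q (by simp [hq]))
        (List.prod_nonneg (by simp)) hr.le
  · rw [inv_pow, inv_mul_le_iff₀ (by positivity)]
    refine hprod.trans ?_
    clear hfw hprod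
    induction l with
    | nil => simp
    | cons p l ih =>
      rw [List.map_cons, List.prod_cons, List.length_cons, pow_succ', periodicProd_cons, norm_mul,
        mul_mul_mul_comm]
      exact mul_le_mul (hMT p (hl p (by simp))) (ih fun q hq => hl q (by simp [hq]))
        (List.prod_nonneg (by simp)) (by positivity)

theorem exists_quotient_bound {ε η : ℝ} (hε : 0 ≤ ε) (hεη : ε < η) :
    ∃ A : ℝ, 0 < A ∧ ∀ (δ M : ℝ) (F H : ℂ → ℂ), 0 < δ → δ < 1 → DifferentiableOn ℂ F (Strip η) →
      DifferentiableOn ℂ H (Strip η) → (∀ z ∈ Strip η, ‖F z‖ ≤ 1) →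
      (∀ z ∈ Strip η, ‖F z * H z‖ ≤ M) → δ ≤ ‖F 0‖ →
      ∀ z ∈ stripBox ε, ‖H z‖ ≤ M * δ ^ (-A) := by
  obtain ⟨φ, T, hT, hTb, hφ, hφS, hφT, hT0⟩ := exists_strip_uniformization (hε.trans_lt hεη)
  obtain ⟨r, hr, hr1, hrT⟩ := exists_norm_lt_one_on_stripBox hε hεη hT hTb
  obtain ⟨R, hrR, hR1⟩ := exists_between hr1
  have hRr : 0 < R - r := by linarith
  refine ⟨1 + 2 * r / (R - r), by positivity, ?_⟩
  intro δ M F H hδ hδ1 hF hH hF1 hFH hδF z hz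
  have hzS := stripBox_subset hεη hz
  have hφ0 : φ 0 = 0 := by
    simpa [hT0] using hφT 0 (stripBox_subset hεη (zero_mem_stripBox hε))
  obtain ⟨n, hn⟩ := exists_pow_lt_of_lt_one hδ hR1
  have := norm_le_of_mul_bounded (M := M) hr.le hrR hR1 n δ (fun z => F (φ z))
    (fun z => H (φ z)) hδ hn (hF.comp hφ hφS) (hH.comp hφ hφS) (fun z hz => hF1 _ (hφS z hz))
    (fun z hz => hFH _ (hφS z hz)) (by simpa [hφ0] using hδF) hδ1 (T z) (hrT z hz)
  simpa [hφT z hzS] using this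

theorem exists_pow_le_rpow_neg {r X : ℝ} (hr : 0 < r) (hr1 : r < 1) (hX : 0 < X) :
    ∃ A : ℝ, 0 < A ∧ ∀ (n : ℕ) (δ : ℝ), 0 < δ → δ ≤ r ^ n → X ^ n ≤ δ ^ (-A) := by
  have hlog : Real.log r < 0 := Real.log_neg hr hr1
  set A : ℝ := |Real.log X| / (-Real.log r) + 1 with hA
  have hA0 : 0 < A := by
    have : 0 ≤ |Real.log X| / (-Real.log r) := div_nonneg (abs_nonneg _) (by linarith)
    linarith
  refine ⟨A, hA0, fun n δ hδ hn => ?_⟩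
  have hXr : X ≤ r ^ (-A) := by
    rw [Real.rpow_def_of_pos hr, ← Real.log_le_iff_le_exp hX]
    have h1 : Real.log r * -A = |Real.log X| - Real.log r := by
      rw [hA]; field_simp [hlog.ne]; ring
    rw [h1]
    linarith [le_abs_self (Real.log X)]
  calc X ^ n ≤ (r ^ (-A)) ^ n := by gcongr
    _ = (r ^ n) ^ (-A) := by
      rw [← Real.rpow_natCast, ← Real.rpow_natCast, ← Real.rpow_mul hr.le, ← Real.rpow_mul hr.le,
        mul_comm]
    _ ≤ δ ^ (-A) := Real.rpow_le_rpow_of_nonpos hδ hn (by linarith)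

theorem exists_sub_zsmul_mem_stripBox {ε : ℝ} {z : ℂ} (hz : z ∈ Strip ε) :
    ∃ n : ℤ, z - n • (1 : ℂ) ∈ stripBox ε := by
  refine ⟨round z.re, Complex.mem_reProdIm.2 ⟨?_, ?_⟩⟩
  · have := abs_le.1 (abs_sub_round z.re)
    simpa using this
  · have := abs_le.1 (le_of_lt (show |z.im| < ε from hz))
    simpa using this

/-- A periodic holomorphic function vanishing at `p` is divisible by the translate of `expSubOne`
vanishing at `p`. -/
theorem exists_eq_expSubOne_mul {η : ℝ} {w : ℂ → ℂ} {p : ℂ} (hw : DifferentiableOn ℂ w (Strip η))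
    (hper : Function.Periodic w 1) (hp : w p = 0) :
    ∃ q : ℂ → ℂ, DifferentiableOn ℂ q (Strip η) ∧ Function.Periodic q 1 ∧
      ∀ z ∈ Strip η, w z = expSubOne (z - p) * q z := by
  have hder : ∀ z, HasDerivAt (fun z => expSubOne (z - p)) (deriv expSubOne (z - p)) z := by
    intro z
    exact (differentiable_expSubOne (z - p)).hasDerivAt.comp_sub_const z p
  have hs : Differentiable ℂ (fun z => expSubOne (z - p)) := fun z => (hder z).differentiableAt
  have hsper : Function.Periodic (fun z => expSubOne (z - p)) 1 := by
    intro z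
    simp only [add_sub_right_comm, expSubOne_add_one]
  obtain ⟨hq, hqe⟩ := exists_holomorphic_quotient (isOpen_strip η) hw hs.differentiableOn (by
    intro z _ hz0
    refine ⟨by rw [(hder z).deriv]; exact deriv_expSubOne_ne_zero _, ?_⟩
    obtain ⟨n, hn⟩ := expSubOne_eq_zero_iff.1 hz0
    have hzn : z = p + n • (1 : ℂ) := by rw [zsmul_one, ← hn]; ring
    rw [hzn, hper.zsmul n p, hp])
  have hderiv : ∀ {f : ℂ → ℂ}, Function.Periodic f 1 → Function.Periodic (deriv f) 1 := by
    intro f hf z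
    rw [← deriv_comp_add_const f 1 z]
    congr 1
    exact funext hf
  refine ⟨_, hq, ?_, hqe⟩
  intro z
  have h1 : expSubOne (z + 1 - p) = expSubOne (z - p) := hsper z
  have h2 := hderiv hper z
  have h3 := hderiv hsper z
  beta_reduce
  rw [h1, hper z, h2, h3]

/-- Two periodic holomorphic functions, the first bounded by `1` and not too small at `0`, can be
divided by a controlled periodic function so that the quotients have no common zero in a
substrip. -/
theorem exists_coprime_quotients {ε η : ℝ} (hε : 0 ≤ ε) (hεη : ε < η) :
    ∃ r κ : ℝ, 0 < r ∧ r < 1 ∧ 0 < κ ∧ ∀ (δ : ℝ) (a b c d : ℂ → ℂ), 0 < δ →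
      DifferentiableOn ℂ a (Strip η) → DifferentiableOn ℂ b (Strip η) →
      DifferentiableOn ℂ c (Strip η) → DifferentiableOn ℂ d (Strip η) →
      Function.Periodic a 1 → Function.Periodic b 1 →
      (∀ z ∈ Strip η, a z * d z = b z * c z) → (∀ z ∈ Strip η, ‖a z‖ ≤ 1) → δ ≤ ‖a 0‖ →
      ∃ (l : List ℂ) (v w : ℂ → ℂ), (∀ p ∈ l, p ∈ stripBox ε) ∧
        DifferentiableOn ℂ v (Strip η) ∧ DifferentiableOn ℂ w (Strip η) ∧
        Function.Periodic v 1 ∧ Function.Periodic w 1 ∧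
        (∀ z ∈ Strip η, a z = periodicProd l z * v z) ∧
        (∀ z ∈ Strip η, b z = periodicProd l z * w z) ∧
        (∀ z ∈ Strip η, v z * d z = w z * c z) ∧
        (∀ z ∈ Strip ε, v z = 0 → w z ≠ 0) ∧
        δ ≤ r ^ l.length ∧ κ ^ l.length * δ ≤ ‖periodicProd l 0‖ := by
  obtain ⟨r, κ, hr, hr1, hκ, hcount⟩ := exists_zero_count_bound hε hεη
  refine ⟨r, κ, hr, hr1, hκ, ?_⟩
  intro δ a b c d hδ ha hb hc hd hpa hpb hdet ha1 hδa
  let Fact : ℕ → Prop := fun n => ∃ (l : List ℂ) (v w : ℂ → ℂ), l.length = n ∧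
    (∀ p ∈ l, p ∈ stripBox ε) ∧ DifferentiableOn ℂ v (Strip η) ∧ DifferentiableOn ℂ w (Strip η) ∧
    Function.Periodic v 1 ∧ Function.Periodic w 1 ∧
    (∀ z ∈ Strip η, a z = periodicProd l z * v z) ∧
    (∀ z ∈ Strip η, b z = periodicProd l z * w z) ∧
    (∀ z ∈ Strip η, v z * d z = w z * c z)
  have hex : ∃ n, ¬ Fact n := by
    obtain ⟨n, hn⟩ := exists_pow_lt_of_lt_one hδ hr1
    refine ⟨n, ?_⟩
    rintro ⟨l, v, w, hlen, hl, hv, -, -, -, hav, -, -⟩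
    have := (hcount l a v hl ha hv ha1 hav).1
    rw [hlen] at this
    linarith
  have hzero : Fact 0 := by
    refine ⟨[], a, b, rfl, by simp, ha, hb, hpa, hpb, by simp, by simp, hdet⟩
  obtain ⟨n, hn, hn1⟩ : ∃ n, Fact n ∧ ¬ Fact (n + 1) := by
    by_contra hcon
    push Not at hcon
    obtain ⟨n, hn⟩ := hex
    exact hn (Nat.rec hzero hcon n)
  obtain ⟨l, v, w, hlen, hl, hv, hw, hpv, hpw, hav, hbw, hvw⟩ := hn
  obtain ⟨hc1, hc2⟩ := hcount l a v hl ha hv ha1 hav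
  refine ⟨l, v, w, hl, hv, hw, hpv, hpw, hav, hbw, hvw, ?_, hδa.trans hc1,
    le_trans (by gcongr) hc2⟩
  intro z hz hvz hwz
  apply hn1
  obtain ⟨k, hk⟩ := exists_sub_zsmul_mem_stripBox hz
  set p := z - k • (1 : ℂ) with hp
  obtain ⟨v', hv', hpv', hvv'⟩ := exists_eq_expSubOne_mul (p := p) hv hpv
    (by rw [hp, hpv.sub_zsmul_eq, hvz])
  obtain ⟨w', hw', hpw', hww'⟩ := exists_eq_expSubOne_mul (p := p) hw hpw
    (by rw [hp, hpw.sub_zsmul_eq, hwz])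
  refine ⟨p :: l, v', w', by simp [hlen], ?_, hv', hw', hpv', hpw', ?_, ?_, ?_⟩
  · intro q hq
    rcases List.mem_cons.1 hq with rfl | hq
    · exact hk
    · exact hl q hq
  · intro x hx
    rw [hav x hx, hvv' x hx, periodicProd_cons]; ring
  · intro x hx
    rw [hbw x hx, hww' x hx, periodicProd_cons]; ring
  · refine eqOn_of_mul_eq (isOpen_strip η) (s := fun z => expSubOne (z - p))
      (fun x _ => ⟨_, deriv_expSubOne_ne_zero (x - p),
        (differentiable_expSubOne (x - p)).hasDerivAt.comp_sub_const x p⟩)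
      (hv'.mul hd).continuousOn (hw'.mul hc).continuousOn ?_
    intro x hx
    have h := hvw x hx
    rw [hvv' x hx, hww' x hx] at h
    linear_combination h

theorem exists_proportionality_factor {U : Set ℂ} (hU : IsOpen U) {v w c d : ℂ → ℂ}
    (hv : DifferentiableOn ℂ v U) (hw : DifferentiableOn ℂ w U) (hc : DifferentiableOn ℂ c U)
    (hd : DifferentiableOn ℂ d U) (h : ∀ z ∈ U, v z * d z = w z * c z)
    (hvw : ∀ z ∈ U, v z = 0 → w z ≠ 0) :
    ∃ k : ℂ → ℂ, DifferentiableOn ℂ k U ∧ (∀ z ∈ U, c z = k z * v z) ∧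
      ∀ z ∈ U, d z = k z * w z := by
  have hcv : ∀ z ∈ U, c z = (if v z = 0 then d z / w z else c z / v z) * v z := by
    intro z hz
    by_cases hvz : v z = 0
    · have := h z hz
      rw [hvz, zero_mul, eq_comm, mul_eq_zero] at this
      simp [hvz, this.resolve_left (hvw z hz hvz)]
    · simp [hvz]
  have hdw : ∀ z ∈ U, d z = (if v z = 0 then d z / w z else c z / v z) * w z := by
    intro z hz
    by_cases hvz : v z = 0
    · simp [hvz, hvw z hz hvz]
    · simp only [hvz, if_false]
      field_simp
      linear_combination h z hz
  refine ⟨_, ?_, hcv, hdw⟩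
  intro p hp
  apply DifferentiableAt.differentiableWithinAt
  have hUp := hU.mem_nhds hp
  have hvp := hv.differentiableAt hUp
  have hwp := hw.differentiableAt hUp
  by_cases hv0 : v p = 0
  · have hw0 := hvw p hp hv0
    refine ((hd.differentiableAt hUp).div hwp hw0).congr_of_eventuallyEq ?_
    filter_upwards [hwp.continuousAt.eventually_ne hw0, hUp] with z hz hzU
    rw [Pi.div_apply, eq_div_iff hz]
    exact (hdw z hzU).symm
  · refine ((hc.differentiableAt hUp).div hvp hv0).congr_of_eventuallyEq ?_
    filter_upwards [hvp.continuousAt.eventually_ne hv0] with z hz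
    simp [hz]

/-- The kernel section when the first entry is not small at `0`. -/
theorem exists_kernel_section_of_le_norm_zero {ε η : ℝ} (hε : 0 < ε) (hεη : ε < η) :
    ∃ B : ℝ, 0 < B ∧ ∀ (δ : ℝ) (a b c d : ℂ → ℂ), 0 < δ → δ < 1 →
      DifferentiableOn ℂ a (Strip η) → DifferentiableOn ℂ b (Strip η) →
      DifferentiableOn ℂ c (Strip η) → DifferentiableOn ℂ d (Strip η) →
      Function.Periodic a 1 → Function.Periodic b 1 →
      Function.Periodic c 1 → Function.Periodic d 1 →
      (∀ z ∈ Strip η, a z * d z = b z * c z) →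
      (∀ z ∈ Strip η, ‖a z‖ ≤ 1 ∧ ‖b z‖ ≤ 1 ∧ ‖c z‖ ≤ 1 ∧ ‖d z‖ ≤ 1) →
      (∀ z ∈ Strip η, δ ≤ ‖a z‖ ∨ δ ≤ ‖b z‖ ∨ δ ≤ ‖c z‖ ∨ δ ≤ ‖d z‖) → δ ≤ ‖a 0‖ →
      ∃ u v : ℂ → ℂ, DifferentiableOn ℂ u (Strip ε) ∧ DifferentiableOn ℂ v (Strip ε) ∧
        Function.Periodic u 1 ∧ Function.Periodic v 1 ∧
        ∀ z ∈ Strip ε, a z * u z + b z * v z = 0 ∧ c z * u z + d z * v z = 0 ∧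
          ‖u z‖ ≤ 1 ∧ ‖v z‖ ≤ 1 ∧ (δ ^ B ≤ ‖u z‖ ∨ δ ^ B ≤ ‖v z‖) := by
  obtain ⟨ε₁, hε₁, hε₁η⟩ := exists_between hεη
  obtain ⟨r, κ, hr, hr1, hκ, hcop⟩ := exists_coprime_quotients (hε.le.trans hε₁.le) hε₁η
  obtain ⟨A₁, hA₁, hquot⟩ := exists_quotient_bound hε.le hεη
  obtain ⟨A₂, hA₂, hquot'⟩ := exists_quotient_bound hε.le hε₁
  set K : ℝ := Real.exp (2 * π * (2 * η)) + 1 with hK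
  have hK1 : 1 ≤ K := by linarith [Real.exp_pos (2 * π * (2 * η))]
  have hK0 : 0 < K := by linarith
  obtain ⟨k, hk, hKk⟩ := exists_pow_le_rpow_neg hr hr1 hK0
  obtain ⟨m, hm, hKm⟩ := exists_pow_le_rpow_neg hr hr1 (X := K / κ) (by positivity)
  set X : ℝ := (m + 1) * A₁ with hX
  set Y : ℝ := k + A₂ with hY
  have hX0 : 0 < X := by positivity
  have hY0 : 0 < Y := by positivity
  refine ⟨X + (1 + Y), by positivity, ?_⟩
  intro δ a b c d hδ hδ1 ha hb hc hd hpa hpb hpc hpd hdet hle hge hδa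
  obtain ⟨l, v, w, hl, hv, hw, hpv, hpw, hav, hbw, hvw, hnz, hlen, hg0⟩ :=
    hcop δ a b c d hδ ha hb hc hd hpa hpb hdet (fun z hz => (hle z hz).1) hδa
  have hsub : Strip ε₁ ⊆ Strip η := fun z hz => lt_trans hz hε₁η
  have hsub' : Strip ε ⊆ Strip η := fun z hz => lt_trans hz hεη
  have hlS : ∀ p ∈ l, p ∈ Strip η := fun p hp => stripBox_subset hε₁η (hl p hp)
  have hgK : ∀ z ∈ Strip η, ‖periodicProd l z‖ ≤ K ^ l.length := fun z hz =>
    norm_periodicProd_le hlS hz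
  have hKpos : 0 < K ^ l.length := by positivity
  have hKδ := hKk l.length δ hδ hlen
  obtain ⟨h, hh, hch, hdh⟩ := exists_proportionality_factor (isOpen_strip ε₁) (hv.mono hsub)
    (hw.mono hsub) (hc.mono hsub) (hd.mono hsub) (fun z hz => hvw z (hsub hz)) hnz
  have hF0 : δ ^ (m + 1) ≤ ‖periodicProd l 0 / (K : ℂ) ^ l.length‖ := by
    have h1 := hKm l.length δ hδ hlen
    rw [Real.rpow_neg hδ.le, div_pow] at h1
    have hδm : 0 < δ ^ m := Real.rpow_pos_of_pos hδ _
    have hκn : 0 < κ ^ l.length := by positivity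
    rw [div_le_iff₀ hκn, inv_mul_eq_div, le_div_iff₀ hδm] at h1
    rw [norm_div, norm_pow, Complex.norm_real, Real.norm_of_nonneg hK0.le, le_div_iff₀ hKpos,
      Real.rpow_add hδ, Real.rpow_one]
    nlinarith
  have hbound : ∀ f q : ℂ → ℂ, DifferentiableOn ℂ q (Strip η) → (∀ z ∈ Strip η, ‖f z‖ ≤ 1) →
      (∀ z ∈ Strip η, f z = periodicProd l z * q z) → ∀ z ∈ stripBox ε, ‖q z‖ ≤ δ ^ (-X) := by
    intro f q hq hf1 hfq z hz
    have := hquot (δ ^ (m + 1)) 1 (fun z => periodicProd l z / (K : ℂ) ^ l.length) q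
      (Real.rpow_pos_of_pos hδ _) (Real.rpow_lt_one hδ.le hδ1 (by linarith))
      ((differentiable_periodicProd l).differentiableOn.div_const _) hq
      (by
        intro x hx
        rw [norm_div, norm_pow, Complex.norm_real, Real.norm_of_nonneg hK0.le, div_le_one hKpos]
        exact hgK x hx)
      (by
        intro x hx
        rw [div_mul_eq_mul_div, ← hfq x hx, norm_div, norm_pow, Complex.norm_real,
          Real.norm_of_nonneg hK0.le, div_le_one hKpos]
        exact (hf1 x hx).trans (one_le_pow₀ hK1)) hF0 z hz
    rwa [one_mul, ← Real.rpow_mul hδ.le, mul_neg] at this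
  have hgY : ∀ z ∈ stripBox ε, ‖periodicProd l z‖ ≤ δ ^ (-Y) := by
    intro z hz
    refine ((hgK z (stripBox_subset hεη hz)).trans hKδ).trans ?_
    exact Real.rpow_le_rpow_of_exponent_ge hδ hδ1.le (by linarith)
  have hhY : ∀ z ∈ stripBox ε, ‖h z‖ ≤ δ ^ (-Y) := by
    intro z hz
    have h1 := hquot' δ (K ^ l.length) a h hδ hδ1 (ha.mono hsub) hh
      (fun x hx => (hle x (hsub hx)).1)
      (by
        intro x hx
        have h2 : a x * h x = periodicProd l x * c x := by
          rw [hav x (hsub hx), hch x hx]; ring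
        rw [h2, norm_mul]
        have h3 := hgK x (hsub hx)
        have h4 := (hle x (hsub hx)).2.2.1
        exact (mul_le_mul h3 h4 (norm_nonneg _) hKpos.le).trans_eq (mul_one _)) hδa z hz
    refine h1.trans ?_
    rw [hY, neg_add, Real.rpow_add hδ]
    gcongr
  have hδX : 0 < δ ^ X := Real.rpow_pos_of_pos hδ _
  have hδY : 0 < δ ^ Y := Real.rpow_pos_of_pos hδ _
  have hnX : ‖((δ ^ X : ℝ) : ℂ)‖ = δ ^ X := by
    rw [Complex.norm_real, Real.norm_of_nonneg hδX.le]
  have hbelow : ∀ f q g : ℂ, f = g * q → ‖g‖ ≤ δ ^ (-Y) → δ ≤ ‖f‖ →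
      δ ^ (X + (1 + Y)) ≤ δ ^ X * ‖q‖ := by
    intro f q g hf hg hδf
    rw [Real.rpow_add hδ, Real.rpow_add hδ, Real.rpow_one]
    refine mul_le_mul_of_nonneg_left ?_ hδX.le
    rw [hf, norm_mul] at hδf
    have h1 : δ ≤ (δ ^ Y)⁻¹ * ‖q‖ := by
      rw [← Real.rpow_neg hδ.le]
      exact hδf.trans (by gcongr)
    rwa [inv_mul_eq_div, le_div_iff₀ hδY] at h1
  have habove : ∀ q : ℂ, ‖q‖ ≤ δ ^ (-X) → δ ^ X * ‖q‖ ≤ 1 := by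
    intro q hq
    rwa [Real.rpow_neg hδ.le, ← one_div, le_div_iff₀ hδX, mul_comm] at hq
  refine ⟨fun z => ((δ ^ X : ℝ) : ℂ) * w z, fun z => -(((δ ^ X : ℝ) : ℂ) * v z),
    (hw.mono hsub').const_mul _, ((hv.mono hsub').const_mul _).fun_neg, fun z => by simp only [hpw z],
    fun z => by simp only [hpv z], ?_⟩
  intro z hz
  have hzS := hsub' hz
  refine ⟨?_, ?_, ?_⟩
  · rw [hav z hzS, hbw z hzS]; ring
  · have hz₁ : z ∈ Strip ε₁ := lt_trans hz hε₁
    rw [hch z hz₁, hdh z hz₁]; ring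
  · obtain ⟨n, hn⟩ := exists_sub_zsmul_mem_stripBox hz
    rw [norm_neg, norm_mul, norm_mul, hnX, ← hpv.sub_zsmul_eq n, ← hpw.sub_zsmul_eq n]
    set x := z - n • (1 : ℂ) with hx
    have hxS : x ∈ Strip η := stripBox_subset hεη hn
    have hx₁ : x ∈ Strip ε₁ := stripBox_subset hε₁ hn
    refine ⟨habove _ (hbound b w hw (fun z hz => (hle z hz).2.1) hbw x hn),
      habove _ (hbound a v hv (fun z hz => (hle z hz).1) hav x hn), ?_⟩
    rcases hge x hxS with h1 | h1 | h1 | h1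
    · exact Or.inr (hbelow _ _ _ (hav x hxS) (hgY x hn) h1)
    · exact Or.inl (hbelow _ _ _ (hbw x hxS) (hgY x hn) h1)
    · exact Or.inr (hbelow _ _ _ (hch x hx₁) (hhY x hn) h1)
    · exact Or.inl (hbelow _ _ _ (hdh x hx₁) (hhY x hn) h1)

/-- A `2 × 2` matrix of norm at least `δ > 0` has an entry of norm at least `δ`. -/
theorem exists_le_norm_entry {M : M2} {δ : ℝ} (hδ : 0 < δ) (h : δ ≤ ‖M‖) :
    ∃ i j, δ ≤ ‖M i j‖ := by
  by_contra! hlt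
  exact absurd ((Matrix.norm_lt_iff hδ).2 hlt) (not_lt.2 h)

/-- **Lemma (kernel section).** Let `0 < ε < ε₀`. There is `C = C(ε₀, ε) > 0` such that for
every matrix function `P` with entries in `C^ω_{ε₀}(ℝ/ℤ, ℂ)`, identically vanishing
determinant, and `δ ≤ ‖P(z)‖ ≤ 1` on the strip, there is `u ∈ C^ω_ε(ℝ/ℤ, ℂ²)` with
`P(z) u(z) = 0` and `C⁻¹ δ^C ≤ ‖u(z)‖ ≤ 1` on the narrower strip. -/
theorem lemma_kernel_section (ε₀ ε : ℝ) (hε : 0 < ε) (hεε₀ : ε < ε₀) :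
    ∃ C : ℝ, 0 < C ∧ ∀ P : ℂ → M2, ∀ δ : ℝ, 0 < δ →
      DifferentiableOn ℂ P (Strip ε₀) → (∀ z : ℂ, P (z + 1) = P z) →
      (∀ z ∈ Strip ε₀, (P z).det = 0) →
      (∀ z ∈ Strip ε₀, δ ≤ ‖P z‖ ∧ ‖P z‖ ≤ 1) →
      ∃ u : ℂ → Fin 2 → ℂ,
        DifferentiableOn ℂ u (Strip ε) ∧ (∀ z : ℂ, u (z + 1) = u z) ∧
        (∀ z ∈ Strip ε, (P z).mulVec (u z) = 0) ∧
        (∀ z ∈ Strip ε, C⁻¹ * δ ^ C ≤ ‖u z‖ ∧ ‖u z‖ ≤ 1) := by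
  obtain ⟨B, hB, hcore⟩ := exists_kernel_section_of_le_norm_zero hε hεε₀
  have h2B : (0 : ℝ) < 2 ^ B := by positivity
  refine ⟨B + 2 ^ B, by positivity, ?_⟩
  intro P δ hδ hP hper hdet hPδ
  have h0 : (0 : ℂ) ∈ Strip ε₀ := by simpa [Strip] using hε.trans hεε₀
  have hδ1 : δ ≤ 1 := (hPδ 0 h0).1.trans (hPδ 0 h0).2
  obtain ⟨i, j, hij⟩ := exists_le_norm_entry hδ (hPδ 0 h0).1
  have hrev : ∀ k i : Fin 2, k = i ∨ k = i.rev := by decide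
  have hd : ∀ k l, DifferentiableOn ℂ (fun z => P z k l) (Strip ε₀) := fun k l =>
    differentiableOn_pi.1 (differentiableOn_pi.1 hP k) l
  have hp : ∀ k l, Function.Periodic (fun z => P z k l) 1 := fun k l z => by simp only [hper z]
  have hle : ∀ z ∈ Strip ε₀, ∀ k l, ‖P z k l‖ ≤ 1 := fun z hz k l =>
    (Matrix.norm_entry_le_entrywise_sup_norm (P z)).trans (hPδ z hz).2
  have hdet2 : ∀ z ∈ Strip ε₀, P z i j * P z i.rev j.rev = P z i j.rev * P z i.rev j := by
    intro z hz
    have h := hdet z hz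
    rw [Matrix.det_fin_two] at h
    fin_cases i <;> fin_cases j <;> simp [Fin.rev] <;>
      first | linear_combination h | linear_combination -h
  have hge : ∀ z ∈ Strip ε₀, δ / 2 ≤ ‖P z i j‖ ∨ δ / 2 ≤ ‖P z i j.rev‖ ∨
      δ / 2 ≤ ‖P z i.rev j‖ ∨ δ / 2 ≤ ‖P z i.rev j.rev‖ := by
    intro z hz
    obtain ⟨k, l, hkl⟩ := exists_le_norm_entry hδ (hPδ z hz).1
    replace hkl : δ / 2 ≤ ‖P z k l‖ := (half_le_self hδ.le).trans hkl
    rcases hrev k i with rfl | rfl <;> rcases hrev l j with rfl | rfl <;> simp [hkl]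
  obtain ⟨u, v, hu, hv, hpu, hpv, huv⟩ := hcore (δ / 2) _ _ _ _ (half_pos hδ) (by linarith)
    (hd i j) (hd i j.rev) (hd i.rev j) (hd i.rev j.rev) (hp i j) (hp i j.rev) (hp i.rev j)
    (hp i.rev j.rev) hdet2 (fun z hz => ⟨hle z hz _ _, hle z hz _ _, hle z hz _ _, hle z hz _ _⟩)
    hge ((half_le_self hδ.le).trans hij)
  have hlow : (B + 2 ^ B)⁻¹ * δ ^ (B + 2 ^ B) ≤ (δ / 2) ^ B := by
    rw [Real.div_rpow hδ.le zero_le_two, div_eq_inv_mul]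
    refine mul_le_mul ?_ ?_ (by positivity) (by positivity)
    · exact inv_anti₀ h2B (by linarith)
    · exact Real.rpow_le_rpow_of_exponent_ge hδ hδ1 (by linarith)
  have hjr : j.rev ≠ j := (by decide : ∀ k : Fin 2, k.rev ≠ k) j
  refine ⟨fun z k => if k = j then u z else v z, ?_, ?_, ?_, ?_⟩
  · refine differentiableOn_pi.2 fun k => ?_
    by_cases hk : k = j
    · simpa only [hk, if_true] using hu
    · simpa only [hk, if_false] using hv
  · intro z
    simp only [hpu z, hpv z]
  · intro z hz
    obtain ⟨h1, h2, -⟩ := huv z hz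
    have hsum : ∀ k, (P z).mulVec (fun l => if l = j then u z else v z) k =
        P z k j * u z + P z k j.rev * v z := by
      intro k
      rw [Matrix.mulVec, dotProduct, Fin.sum_univ_two]
      fin_cases j <;> simp [Fin.rev, add_comm]
    funext k
    rw [hsum, Pi.zero_apply]
    rcases hrev k i with rfl | rfl
    · exact h1
    · exact h2
  · intro z hz
    obtain ⟨-, -, h3, h4, h5⟩ := huv z hz
    constructor
    · refine hlow.trans ?_
      rcases h5 with h5 | h5
      · exact h5.trans (by simpa using norm_le_pi_norm (fun k => if k = j then u z else v z) j)
      · exact h5.trans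
          (by simpa [hjr] using norm_le_pi_norm (fun k => if k = j then u z else v z) j.rev)
    · refine (pi_norm_le_iff_of_nonneg zero_le_one).2 fun k => ?_
      dsimp only
      split_ifs
      · exact h3
      · exact h4
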